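/- The real numbers x = (√2)^(√2) and y = √2 are both irrational and x^y = 2 is rational; hence they witness that there exist irrational real numbers x and y with x^y rational. -/

import Mathlib

/-- Rolle on finite sets of zeros. -/
lemma rolle_finset (f : ℝ → ℝ) (hf : Continuous f) (a b : ℝ) (k : ℕ) (Z : Finset ℝ)
    (hZ : ∀ z ∈ Z, z ∈ Set.Icc a b ∧ f z = 0) (hc : Z.card = k + 1) :
    ∃ Z' : Finset ℝ, (∀ z ∈ Z', z ∈ Set.Icc a b ∧ deriv f z = 0) ∧ Z'.card = k := by
  set e := Z.orderEmbOfFin hc with he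
  have hmem : ∀ i, e i ∈ Z := fun i => Finset.orderEmbOfFin_mem Z hc i
  have h : ∀ i : Fin k, ∃ c ∈ Set.Ioo (e i.castSucc) (e i.succ), deriv f c = 0 := by
    intro i
    apply exists_deriv_eq_zero
    · exact e.strictMono Fin.castSucc_lt_succ
    · exact hf.continuousOn
    · rw [(hZ _ (hmem _)).2, (hZ _ (hmem _)).2]
  choose c hc1 hc2 using h
  have hmono : StrictMono c := by
    intro i j hij
    have : e i.succ ≤ e j.castSucc := e.monotone (by
      rw [Fin.le_def]; simp; exact hij)
    linarith [(hc1 i).2, (hc1 j).1]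
  refine ⟨Finset.univ.map ⟨c, hmono.injective⟩, ?_, by simp⟩
  intro z hz
  simp only [Finset.mem_map, Finset.mem_univ, true_and, Function.Embedding.coeFn_mk] at hz
  obtain ⟨i, rfl⟩ := hz
  refine ⟨⟨?_, ?_⟩, hc2 i⟩
  · linarith [(hc1 i).1, (hZ _ (hmem i.castSucc)).1.1]
  · linarith [(hc1 i).2, (hZ _ (hmem i.succ)).1.2]

lemma rolle_iter (f : ℝ → ℝ) (hf : ContDiff ℝ (⊤ : ℕ∞) f) (a b : ℝ) (n k : ℕ) (Z : Finset ℝ)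
    (hZ : ∀ z ∈ Z, z ∈ Set.Icc a b ∧ f z = 0) (hc : Z.card = k + n) :
    ∃ Z' : Finset ℝ, (∀ z ∈ Z', z ∈ Set.Icc a b ∧ iteratedDeriv n f z = 0) ∧ Z'.card = k := by
  induction n generalizing k with
  | zero => exact ⟨Z, by simpa using hZ, by simpa using hc⟩
  | succ n ih =>
    obtain ⟨Z1, h1, h2⟩ := ih (k + 1) (by omega)
    have hcont : Continuous (iteratedDeriv n f) :=
      hf.continuous_iteratedDeriv n (by exact_mod_cast le_top)
    obtain ⟨Z2, h3, h4⟩ := rolle_finset _ hcont a b k Z1 h1 h2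
    refine ⟨Z2, ?_, h4⟩
    rw [iteratedDeriv_succ]
    exact h3

lemma iteratedDeriv_poly (P : Polynomial ℝ) (n : ℕ) :
    iteratedDeriv n (fun x => P.eval x) = fun x => (Polynomial.derivative^[n] P).eval x := by
  induction n with
  | zero => simp
  | succ n ih =>
    rw [iteratedDeriv_succ, ih, Function.iterate_succ_apply']
    ext x
    simp

lemma interp_error (f : ℝ → ℝ) (hf : ContDiff ℝ (⊤ : ℕ∞) f) (a b : ℝ) (M : ℕ) (Z : Finset ℝ)
    (hZ : ∀ z ∈ Z, z ∈ Set.Icc a b ∧ f z = 0) (hc : Z.card = M) (t : ℝ) (ht : t ∈ Set.Icc a b) :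
    ∃ ξ ∈ Set.Icc a b, f t * (M.factorial : ℝ) = iteratedDeriv M f ξ * ∏ z ∈ Z, (t - z) := by
  by_cases htZ : t ∈ Z
  · refine ⟨t, ht, ?_⟩
    rw [(hZ t htZ).2, Finset.prod_eq_zero htZ (sub_self t)]; simp
  set P : Polynomial ℝ := ∏ z ∈ Z, (Polynomial.X - Polynomial.C z) with hP
  have hPe : ∀ x, P.eval x = ∏ z ∈ Z, (x - z) := by
    intro x; simp [hP, Polynomial.eval_prod]
  have hPt : P.eval t ≠ 0 := by
    rw [hPe]
    exact Finset.prod_ne_zero_iff.2 fun z hz h => htZ (by rwa [sub_eq_zero.1 h])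
  have hmon : P.Monic := Polynomial.monic_prod_X_sub_C _ _
  have hdeg : P.natDegree = M := by
    rw [hP, Polynomial.natDegree_finsetProd_X_sub_C_eq_card, hc]
  set K := f t / P.eval t with hK
  set g : ℝ → ℝ := fun x => f x - K * P.eval x with hg
  have hPc : ContDiff ℝ (⊤ : ℕ∞) (fun x => P.eval x) := by
    simpa using Polynomial.contDiff_aeval (𝕜 := ℝ) P ((⊤ : ℕ∞) : WithTop ℕ∞)
  have hgc : ContDiff ℝ (⊤ : ℕ∞) g := hf.sub (contDiff_const.mul hPc)
  obtain ⟨Z', h1, h2⟩ := rolle_iter g hgc a b M 1 (insert t Z) (by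
    intro z hz
    rcases Finset.mem_insert.1 hz with rfl | hz
    · refine ⟨ht, ?_⟩
      simp only [hg, hK]; field_simp; ring
    · refine ⟨(hZ z hz).1, ?_⟩
      simp only [hg, (hZ z hz).2, hPe, Finset.prod_eq_zero hz (sub_self z)]; simp) (by
    rw [Finset.card_insert_of_notMem htZ, hc, add_comm])
  obtain ⟨ξ, hξ⟩ := Finset.card_pos.1 (by rw [h2]; norm_num : 0 < Z'.card)
  refine ⟨ξ, (h1 ξ hξ).1, ?_⟩
  have h3 := (h1 ξ hξ).2
  have hMle : ((M : ℕ∞) : WithTop ℕ∞) ≤ ((⊤ : ℕ∞) : WithTop ℕ∞) := by exact_mod_cast le_top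
  have h4 : iteratedDeriv M g ξ = iteratedDeriv M f ξ - K * (M.factorial : ℝ) := by
    have : g = f - (fun x => K * P.eval x) := rfl
    rw [this, iteratedDeriv_sub (hf.contDiffAt.of_le hMle)
      ((contDiff_const.mul hPc).contDiffAt.of_le hMle),
      iteratedDeriv_const_mul K (hPc.contDiffAt.of_le hMle), iteratedDeriv_poly]
    congr 2
    have h5 : (Polynomial.derivative^[M] P).natDegree ≤ 0 :=
      (Polynomial.natDegree_iterate_derivative P M).trans (by omega)
    rw [Polynomial.eq_C_of_natDegree_le_zero h5]
    simp only [Polynomial.eval_C]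
    rw [
      Polynomial.coeff_iterate_derivative]
    have : P.coeff M = 1 := by rw [← hdeg]; exact hmon
    simp [this, Nat.descFactorial_self]
  rw [h4] at h3
  have h5 : iteratedDeriv M f ξ = K * (M.factorial : ℝ) := by linarith
  rw [h5, ← hPe, hK]; field_simp

/-- The derivative operator on the polynomial coefficient of `exp (j w t)`. -/
noncomputable def TT (w : ℝ) (j : ℕ) (P : Polynomial ℝ) : Polynomial ℝ :=
  Polynomial.derivative P + Polynomial.C (j * w) * P

/-- exponential polynomials -/
noncomputable def EP (w : ℝ) (J : ℕ) (P : ℕ → Polynomial ℝ) (t : ℝ) : ℝ :=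
  ∑ j ∈ Finset.range J, (P j).eval t * Real.exp (j * w * t)

lemma EP_contDiff (w : ℝ) (J : ℕ) (P : ℕ → Polynomial ℝ) : ContDiff ℝ (⊤ : ℕ∞) (EP w J P) := by
  unfold EP
  apply ContDiff.sum
  intro j _
  apply ContDiff.mul
  · simpa using Polynomial.contDiff_aeval (𝕜 := ℝ) (P j) ((⊤ : ℕ∞) : WithTop ℕ∞)
  · fun_prop

lemma EP_deriv (w : ℝ) (J : ℕ) (P : ℕ → Polynomial ℝ) :
    deriv (EP w J P) = EP w J (fun j => TT w j (P j)) := by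
  ext t
  apply HasDerivAt.deriv
  unfold EP
  apply HasDerivAt.fun_sum
  intro j _
  have h1 := (P j).hasDerivAt t
  have h2 : HasDerivAt (fun t : ℝ => Real.exp (j * w * t)) (Real.exp (j * w * t) * (j * w)) t := by
    simpa using ((hasDerivAt_id t).const_mul (j * w : ℝ)).exp
  refine (h1.fun_mul h2).congr_deriv ?_
  simp only [TT, Polynomial.eval_add, Polynomial.eval_mul, Polynomial.eval_C]; ring

lemma EP_iteratedDeriv (w : ℝ) (J : ℕ) (P : ℕ → Polynomial ℝ) (n : ℕ) :
    iteratedDeriv n (EP w J P) = EP w J (fun j => (TT w j)^[n] (P j)) := by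
  induction n with
  | zero => simp
  | succ n ih =>
    rw [iteratedDeriv_succ, ih, EP_deriv]
    simp only [Function.iterate_succ_apply']

lemma TT_degree (w : ℝ) (j I : ℕ) (P : Polynomial ℝ) (h : P.degree < I) : (TT w j P).degree < I := by
  unfold TT
  refine (Polynomial.degree_add_le _ _).trans_lt (max_lt ?_ ?_)
  · exact (Polynomial.degree_derivative_le).trans_lt h
  · refine lt_of_le_of_lt ?_ h
    rw [← Polynomial.smul_eq_C_mul]
    exact Polynomial.degree_smul_le _ _

lemma TT_degree_iter (w : ℝ) (j I n : ℕ) (P : Polynomial ℝ) (h : P.degree < I) :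
    ((TT w j)^[n] P).degree < I := by
  induction n with
  | zero => simpa
  | succ n ih => rw [Function.iterate_succ_apply']; exact TT_degree _ _ _ _ ih

lemma TT_inj (w : ℝ) (hw : w ≠ 0) (j : ℕ) (hj : j ≠ 0) (P : Polynomial ℝ) (h : TT w j P = 0) :
    P = 0 := by
  by_contra hP
  have h1 := Polynomial.degree_derivative_lt hP
  have hne : (j * w : ℝ) ≠ 0 := mul_ne_zero (by exact_mod_cast hj) hw
  have h2 : (Polynomial.C (j * w : ℝ) * P).degree = P.degree := Polynomial.degree_C_mul hne
  unfold TT at h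
  rw [eq_neg_of_add_eq_zero_left h, Polynomial.degree_neg, h2] at h1
  exact lt_irrefl _ h1

lemma TT_inj_iter (w : ℝ) (hw : w ≠ 0) (j : ℕ) (hj : j ≠ 0) (n : ℕ) (P : Polynomial ℝ)
    (h : (TT w j)^[n] P = 0) : P = 0 := by
  induction n with
  | zero => simpa using h
  | succ n ih =>
    rw [Function.iterate_succ_apply'] at h
    exact ih (TT_inj w hw j hj _ h)

lemma EP_zeros (w : ℝ) (hw : w ≠ 0) (I : ℕ) (a b : ℝ) (J : ℕ) (P : ℕ → Polynomial ℝ)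
    (hdeg : ∀ j < J, (P j).degree < I) (Z : Finset ℝ)
    (hZ : ∀ z ∈ Z, z ∈ Set.Icc a b ∧ EP w J P z = 0) (hc : Z.card = J * I) :
    ∀ j < J, P j = 0 := by
  induction J generalizing P Z with
  | zero => intro j hj; omega
  | succ J ih =>
    obtain ⟨Z', h1, h2⟩ := rolle_iter _ (EP_contDiff w (J + 1) P) a b I (J * I) Z hZ
      (by rw [hc]; ring)
    have hpos : ∀ j < J, P (j + 1) = 0 := by
      intro j hj
      apply TT_inj_iter w hw (j + 1) (by omega) I
      refine ih (fun j => (TT w (j + 1))^[I] (P (j + 1)))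
        (fun j hj => TT_degree_iter _ _ _ _ _ (hdeg _ (by omega))) Z' ?_ h2 j hj
      intro z hz
      refine ⟨(h1 z hz).1, ?_⟩
      have h3 := (h1 z hz).2
      rw [EP_iteratedDeriv] at h3
      unfold EP at h3 ⊢
      rw [Finset.sum_range_succ'] at h3
      have h0 : (TT w 0)^[I] (P 0) = 0 := by
        have : TT w 0 = fun P => Polynomial.derivative P := by
          ext1 P; simp [TT]
        rw [this]
        rcases Nat.eq_zero_or_pos I with hI | hI
        · subst hI
          have := hdeg 0 (by omega)
          simp only [Function.iterate_zero, id]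
          by_contra hne
          rw [Polynomial.degree_eq_natDegree hne] at this
          norm_cast at this
        · apply Polynomial.iterate_derivative_eq_zero
          by_cases hne : P 0 = 0
          · rw [hne]; simpa using hI
          · exact (Polynomial.natDegree_lt_iff_degree_lt hne).2 (hdeg 0 (by omega))
      simp only [] at h3
      rw [h0] at h3
      simp only [Polynomial.eval_zero, zero_mul, add_zero] at h3
      have h4 : ∀ j ∈ Finset.range J, ((TT w (j + 1))^[I] (P (j + 1))).eval z *
          Real.exp (((j + 1 : ℕ) : ℝ) * w * z) = Real.exp (w * z) *
          (((TT w (j + 1))^[I] (P (j + 1))).eval z * Real.exp (j * w * z)) := by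
        intro j _
        have : ((j + 1 : ℕ) : ℝ) * w * z = w * z + j * w * z := by push_cast; ring
        rw [this, Real.exp_add]; ring
      rw [Finset.sum_congr rfl h4, ← Finset.mul_sum] at h3
      exact (mul_eq_zero.1 h3).resolve_left (Real.exp_ne_zero _)
    intro j hj
    rcases j with _ | j
    · have hz : ∀ z ∈ Z, (P 0).eval z = 0 := by
        intro z hz
        have h3 := (hZ z hz).2
        unfold EP at h3
        rw [Finset.sum_range_succ', Finset.sum_eq_zero] at h3
        · simpa using h3
        · intro i hi
          rw [hpos i (Finset.mem_range.1 hi)]; simp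
      refine Polynomial.eq_zero_of_degree_lt_of_eval_finset_eq_zero Z ?_ hz
      refine (hdeg 0 (by omega)).trans_le ?_
      rw [hc]
      exact_mod_cast Nat.le_mul_of_pos_left I (Nat.succ_pos J)
    · exact hpos j (by omega)

lemma deriv_bound (I M i : ℕ) (hI : 1 ≤ I) (hi : i ≤ I) (R L l t : ℝ) (hR : 1 ≤ R) (hL : 1 ≤ L)
    (hl0 : 0 ≤ l) (hl : l ≤ L) (ht0 : 0 ≤ t) (ht : t ≤ R) :
    |iteratedDeriv M (fun t => t ^ i * Real.exp (l * t)) t| ≤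
      2 ^ M * ((I : ℝ) ^ I * R ^ I * L ^ M * Real.exp (L * R)) := by
  have hf : (fun t : ℝ => t ^ i * Real.exp (l * t)) =
    (fun t : ℝ => t ^ i) * (fun t => Real.exp (l * t)) := rfl
  rw [hf, iteratedDeriv_mul (by fun_prop) (by fun_prop)]
  have h2 : (2 : ℝ) ^ M = ∑ m ∈ Finset.range (M + 1), (M.choose m : ℝ) := by
    exact_mod_cast (Nat.sum_range_choose M).symm
  rw [h2, Finset.sum_mul]
  refine (Finset.abs_sum_le_sum_abs _ _).trans (Finset.sum_le_sum ?_)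
  intro m hm
  rw [iteratedDeriv_pow, iteratedDeriv_exp_const_mul]
  have hI' : (1 : ℝ) ≤ I := by exact_mod_cast hI
  rw [abs_of_nonneg (by positivity)]
  have e1 : (i.descFactorial m : ℝ) ≤ (I : ℝ) ^ I := by
    have : i.descFactorial m ≤ I ^ I := by
      rcases lt_or_ge i m with h | h
      · rw [Nat.descFactorial_eq_zero_iff_lt.2 h]; positivity
      · calc _ ≤ i ^ m := Nat.descFactorial_le_pow i m
          _ ≤ I ^ m := Nat.pow_le_pow_left hi m
          _ ≤ I ^ I := Nat.pow_le_pow_right hI (h.trans hi)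
    exact_mod_cast this
  have e2 : t ^ (i - m) ≤ R ^ I :=
    (pow_le_pow_left₀ ht0 ht _).trans (pow_le_pow_right₀ hR (by omega))
  have e3 : l ^ (M - m) ≤ L ^ M :=
    (pow_le_pow_left₀ hl0 hl _).trans (pow_le_pow_right₀ hL (by omega))
  have e4 : Real.exp (l * t) ≤ Real.exp (L * R) := Real.exp_le_exp.2 (by gcongr)
  calc _ = (M.choose m : ℝ) * ((i.descFactorial m : ℝ) * t ^ (i - m) * l ^ (M - m) * Real.exp (l * t)) := by
        ring
    _ ≤ _ := by gcongr

/-- size of an element of `ℤ[√2]` -/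
def sz (z : ℤ√2) : ℤ := |z.re| + 2 * |z.im|

lemma sz_add (z w : ℤ√2) : sz (z + w) ≤ sz z + sz w := by
  unfold sz
  simp only [Zsqrtd.re_add, Zsqrtd.im_add]
  linarith [abs_add_le z.re w.re, abs_add_le z.im w.im]

lemma sz_mul (z w : ℤ√2) : sz (z * w) ≤ sz z * sz w := by
  unfold sz
  simp only [Zsqrtd.re_mul, Zsqrtd.im_mul]
  have h1 := abs_add_le (z.re * w.re) (2 * z.im * w.im)
  have h2 := abs_add_le (z.re * w.im) (z.im * w.re)
  simp only [abs_mul, abs_two] at h1 h2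
  nlinarith [mul_nonneg (abs_nonneg z.im) (abs_nonneg w.im)]

lemma sz_nonneg (z : ℤ√2) : 0 ≤ sz z := by unfold sz; positivity

lemma sz_int (k : ℤ) : sz (k : ℤ√2) = |k| := by simp [sz]

lemma sz_nat (k : ℕ) : sz (k : ℤ√2) = k := by simp [sz]

lemma sz_pow (z : ℤ√2) (i : ℕ) : sz (z ^ i) ≤ sz z ^ i := by
  induction i with
  | zero => simp [sz]
  | succ i ih =>
    rw [pow_succ, pow_succ]
    exact (sz_mul _ _).trans (mul_le_mul_of_nonneg_right ih (sz_nonneg _))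

lemma sz_sum {ι : Type*} (s : Finset ι) (f : ι → ℤ√2) : sz (∑ i ∈ s, f i) ≤ ∑ i ∈ s, sz (f i) := by
  classical
  induction s using Finset.induction_on with
  | empty => simp [sz]
  | insert a s ha ih =>
    rw [Finset.sum_insert ha, Finset.sum_insert ha]
    exact (sz_add _ _).trans (by linarith)

/-- the real embedding -/
noncomputable def ph : ℤ√2 →+* ℝ := Zsqrtd.toReal (by norm_num : (0 : ℤ) ≤ 2)

lemma ph_apply (z : ℤ√2) : ph z = z.re + z.im * Real.sqrt 2 := by
  simp [ph]

lemma two_nonsq (n : ℤ) : (2 : ℤ) ≠ n * n := by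
  intro h
  have h1 : n < 2 := by nlinarith
  have h2 : -2 < n := by nlinarith
  interval_cases n <;> omega

lemma ph_inj : Function.Injective ph := Zsqrtd.toReal_injective _ two_nonsq

lemma sqrt_two_lt : Real.sqrt 2 < 2 := by
  rw [Real.sqrt_lt' (by norm_num)]; norm_num

lemma ph_le (z : ℤ√2) : |ph z| ≤ sz z := by
  rw [ph_apply]
  refine (abs_add_le _ _).trans ?_
  rw [abs_mul, abs_of_nonneg (Real.sqrt_nonneg 2)]
  unfold sz
  push_cast
  nlinarith [sqrt_two_lt, abs_nonneg (z.im : ℝ)]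

lemma sz_star (z : ℤ√2) : sz (star z) = sz z := by simp [sz]

lemma one_le_ph (z : ℤ√2) (hz : z ≠ 0) : 1 ≤ |ph z| * (sz z : ℝ) := by
  have h1 : z.norm ≠ 0 := fun h => hz ((Zsqrtd.norm_eq_zero two_nonsq z).1 h)
  have h2 : ph z * ph (star z) = (z.norm : ℝ) := by
    rw [← map_mul, ← Zsqrtd.norm_eq_mul_conj]; simp
  have h3 : (1 : ℝ) ≤ |(z.norm : ℝ)| := by exact_mod_cast Int.one_le_abs h1
  rw [← h2, abs_mul] at h3
  refine h3.trans (mul_le_mul_of_nonneg_left ?_ (abs_nonneg _))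
  rw [← sz_star]; exact ph_le _

/-- the integer `q^(2n) 2^(a + b √2)` -/
def ee (p q n a b : ℕ) : ℕ := 2 ^ a * p ^ b * q ^ (2 * n - b)

/-- the algebraic evaluation of the auxiliary function -/
def GG (p q n I : ℕ) (x : ℕ → ℕ → ℤ) (a b : ℕ) : ℤ√2 :=
  ∑ j ∈ Finset.range 28, ∑ i ∈ Finset.range I,
    (x i j : ℤ√2) * ((⟨a, b⟩ : ℤ√2) ^ i * ((ee p q n a b : ℕ) : ℤ√2) ^ j)

lemma ee_le (p q n a b : ℕ) (hp : 0 < p) (hq : 0 < q) (ha : a ≤ 2 * n) (hb : b ≤ 2 * n) :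
    ee p q n a b ≤ (2 * p * q) ^ (2 * n) := by
  unfold ee
  rw [mul_pow, mul_pow]
  have := Nat.pow_le_pow_right (by norm_num : 0 < 2) ha
  have := Nat.pow_le_pow_right hp hb
  have := Nat.pow_le_pow_right hq (by omega : 2 * n - b ≤ 2 * n)
  gcongr

lemma mono_sz (p q n I a b i j : ℕ) (hn : 0 < n) (hp : 0 < p) (hq : 0 < q) (ha : a ≤ 2 * n)
    (hb : b ≤ 2 * n) (hi : i ≤ I) (hj : j ≤ 28) :
    sz ((⟨a, b⟩ : ℤ√2) ^ i * ((ee p q n a b : ℕ) : ℤ√2) ^ j) ≤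
      ((6 * n) ^ I * (2 * p * q) ^ (56 * n) : ℕ) := by
  refine (sz_mul _ _).trans ?_
  have h1 : sz ((⟨a, b⟩ : ℤ√2) ^ i) ≤ ((6 * n) ^ I : ℕ) := by
    refine (sz_pow _ _).trans ?_
    have h : sz (⟨a, b⟩ : ℤ√2) = ((a + 2 * b : ℕ) : ℤ) := by simp [sz]
    rw [h]
    have : (a + 2 * b) ^ i ≤ (6 * n) ^ I :=
      (Nat.pow_le_pow_left (by omega) i).trans (Nat.pow_le_pow_right (by omega) hi)
    exact_mod_cast this
  have h2 : sz (((ee p q n a b : ℕ) : ℤ√2) ^ j) ≤ ((2 * p * q) ^ (56 * n) : ℕ) := by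
    rw [← Nat.cast_pow, sz_nat]
    have h := ee_le p q n a b hp hq ha hb
    have : ee p q n a b ^ j ≤ (2 * p * q) ^ (56 * n) := by
      refine (Nat.pow_le_pow_left h j).trans ?_
      rw [← pow_mul]
      exact Nat.pow_le_pow_right (by positivity) (by nlinarith)
    exact_mod_cast this
  push_cast at h1 h2 ⊢
  exact mul_le_mul h1 h2 (sz_nonneg _) (by positivity)

lemma re_sum {ι : Type*} (s : Finset ι) (f : ι → ℤ√2) : (∑ i ∈ s, f i).re = ∑ i ∈ s, (f i).re := by
  classical
  induction s using Finset.induction_on with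
  | empty => simp
  | insert a s ha ih => rw [Finset.sum_insert ha, Finset.sum_insert ha, Zsqrtd.re_add, ih]

lemma im_sum {ι : Type*} (s : Finset ι) (f : ι → ℤ√2) : (∑ i ∈ s, f i).im = ∑ i ∈ s, (f i).im := by
  classical
  induction s using Finset.induction_on with
  | empty => simp
  | insert a s ha ih => rw [Finset.sum_insert ha, Finset.sum_insert ha, Zsqrtd.im_add, ih]

section
attribute [local instance] Matrix.seminormedAddCommGroup

lemma siegel (p q n I : ℕ) (hn : 0 < n) (hp : 0 < p) (hq : 0 < q) (hI : 28 * I = 4 * n ^ 2) :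
    ∃ x : ℕ → ℕ → ℤ, (∃ i < I, ∃ j < 28, x i j ≠ 0) ∧
      (∀ i j, |x i j| ≤ (4 * n ^ 2 * ((6 * n) ^ I * (2 * p * q) ^ (56 * n)) : ℕ)) ∧
      ∀ a < n, ∀ b < n, GG p q n I x a b = 0 := by
  set H : ℕ := (6 * n) ^ I * (2 * p * q) ^ (56 * n) with hH
  have hHpos : 0 < H := by positivity
  let mon : Fin n × Fin n → Fin I × Fin 28 → ℤ√2 := fun ab ij =>
    (⟨(ab.1 : ℕ), (ab.2 : ℕ)⟩ : ℤ√2) ^ (ij.1 : ℕ) *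
      ((ee p q n ab.1 ab.2 : ℕ) : ℤ√2) ^ (ij.2 : ℕ)
  let A : Matrix ((Fin n × Fin n) × Bool) (Fin I × Fin 28) ℤ := fun r ij =>
    if r.2 then (mon r.1 ij).re else (mon r.1 ij).im
  have hsz : ∀ ab ij, sz (mon ab ij) ≤ H := fun ab ij =>
    mono_sz p q n I _ _ _ _ hn hp hq (by omega) (by omega) (by omega) (by omega)
  have hA : ‖A‖ ≤ H := by
    rw [Matrix.norm_le_iff (by positivity)]
    intro r ij
    rw [Int.norm_eq_abs]
    have h1 := hsz r.1 ij
    unfold sz at h1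
    have h2 : |A r ij| ≤ H := by
      have := abs_nonneg (mon r.1 ij).re
      have := abs_nonneg (mon r.1 ij).im
      simp only [A]
      split_ifs <;> linarith
    exact_mod_cast h2
  have hcr : Fintype.card ((Fin n × Fin n) × Bool) = 2 * n ^ 2 := by
    simp; ring
  have hcc : Fintype.card (Fin I × Fin 28) = 4 * n ^ 2 := by
    simp; omega
  have hn2 : 0 < n ^ 2 := by positivity
  obtain ⟨t, ht0, ht1, ht2⟩ := Int.Matrix.exists_ne_zero_int_vec_norm_le A
    (by rw [hcr, hcc]; omega) (by rw [hcr]; omega)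
  rw [hcr, hcc] at ht2
  have hexp : (((2 * n ^ 2 : ℕ) : ℝ) / (((4 * n ^ 2 : ℕ) : ℝ) - ((2 * n ^ 2 : ℕ) : ℝ))) = 1 := by
    push_cast
    have : (n : ℝ) ≠ 0 := by positivity
    field_simp; norm_num
  rw [hexp, Real.rpow_one] at ht2
  have ht3 : ‖t‖ ≤ ((4 * n ^ 2 * H : ℕ) : ℝ) := by
    refine ht2.trans ?_
    rw [Nat.cast_mul (4 * n ^ 2) H]
    refine mul_le_mul_of_nonneg_left (max_le ?_ hA) (by positivity)
    exact_mod_cast hHpos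
  refine ⟨fun i j => if h : i < I ∧ j < 28 then t (⟨i, h.1⟩, ⟨j, h.2⟩) else 0, ?_, ?_, ?_⟩
  · obtain ⟨ij, hij⟩ := Function.ne_iff.1 ht0
    refine ⟨ij.1, ij.1.2, ij.2, ij.2.2, ?_⟩
    simpa using hij
  · intro i j
    simp only
    split_ifs with h
    · have := (norm_le_pi_norm t (⟨i, h.1⟩, ⟨j, h.2⟩)).trans ht3
      rw [Int.norm_eq_abs] at this
      exact_mod_cast this
    · simp only [abs_zero]; positivity
  · intro a ha b hb
    have hG : GG p q n I (fun i j => if h : i < I ∧ j < 28 then t (⟨i, h.1⟩, ⟨j, h.2⟩) else 0) a b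
        = ∑ ij, (t ij : ℤ√2) * mon (⟨a, ha⟩, ⟨b, hb⟩) ij := by
      unfold GG
      rw [Fintype.sum_prod_type_right, Finset.sum_range]
      refine Finset.sum_congr rfl fun j _ => ?_
      rw [Finset.sum_range]
      refine Finset.sum_congr rfl fun i _ => ?_
      simp [mon]
    rw [hG]
    have hr := congrFun ht1 ((⟨a, ha⟩, ⟨b, hb⟩), true)
    have hi := congrFun ht1 ((⟨a, ha⟩, ⟨b, hb⟩), false)
    simp only [Matrix.mulVec, dotProduct, A, Pi.zero_apply, if_true, Bool.false_eq_true, if_false] at hr hi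
    ext
    · rw [re_sum, Zsqrtd.re_zero, ← hr]
      refine Finset.sum_congr rfl fun ij _ => ?_
      simp [mul_comm]
    · rw [im_sum, Zsqrtd.im_zero, ← hi]
      refine Finset.sum_congr rfl fun ij _ => ?_
      simp [mul_comm]

end

lemma GG_sz (p q n I : ℕ) (hn : 0 < n) (hp : 0 < p) (hq : 0 < q) (hI : 28 * I = 4 * n ^ 2)
    (x : ℕ → ℕ → ℤ) (X : ℕ) (hX : X = 4 * n ^ 2 * ((6 * n) ^ I * (2 * p * q) ^ (56 * n)))
    (hx : ∀ i j, |x i j| ≤ X) (a b : ℕ) (ha : a ≤ 2 * n) (hb : b ≤ 2 * n) :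
    sz (GG p q n I x a b) ≤ (X : ℤ) ^ 2 := by
  have h1 : sz (GG p q n I x a b) ≤ ∑ j ∈ Finset.range 28, ∑ i ∈ Finset.range I,
      (X : ℤ) * ((6 * n) ^ I * (2 * p * q) ^ (56 * n) : ℕ) := by
    unfold GG
    refine (sz_sum _ _).trans (Finset.sum_le_sum fun j hj => ?_)
    refine (sz_sum _ _).trans (Finset.sum_le_sum fun i hi => ?_)
    refine (sz_mul _ _).trans ?_
    rw [sz_int]
    exact mul_le_mul (hx i j) (mono_sz p q n I a b i j hn hp hq ha hb
      (Finset.mem_range.1 hi).le (Finset.mem_range.1 hj).le) (sz_nonneg _) (by positivity)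
  refine h1.trans (le_of_eq ?_)
  simp only [Finset.sum_const, Finset.card_range, nsmul_eq_mul]
  rw [pow_two]
  nth_rewrite 3 [hX]
  rw [← hI]
  push_cast
  ring

lemma ee_real (p q n a b : ℕ) (hq : 0 < q) (hb : b ≤ 2 * n)
    (h : (2 : ℝ) ^ (Real.sqrt 2) = p / q) :
    (ee p q n a b : ℝ) = (q : ℝ) ^ (2 * n) * Real.exp (Real.log 2 * (a + b * Real.sqrt 2)) := by
  have h1 : Real.exp (Real.log 2 * (a + b * Real.sqrt 2)) = 2 ^ a * (p / q : ℝ) ^ b := by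
    rw [← h, ← Real.rpow_def_of_pos (by norm_num), Real.rpow_add (by norm_num), Real.rpow_natCast,
      mul_comm (b : ℝ), Real.rpow_mul (by norm_num), Real.rpow_natCast]
  rw [h1]
  unfold ee
  have hq' : (q : ℝ) ≠ 0 := by positivity
  have h2 : (q : ℝ) ^ (2 * n) = q ^ (2 * n - b) * q ^ b := by
    rw [← pow_add]; congr 1; omega
  push_cast
  rw [h2, div_pow]
  field_simp

/-- polynomial coefficients of the auxiliary function -/
noncomputable def PP (q n I : ℕ) (x : ℕ → ℕ → ℤ) (j : ℕ) : Polynomial ℝ :=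
  ∑ i ∈ Finset.range I, Polynomial.C ((x i j : ℝ) * ((q : ℝ) ^ (2 * n)) ^ j) * Polynomial.X ^ i

lemma PP_degree (q n I : ℕ) (x : ℕ → ℕ → ℤ) (j : ℕ) : (PP q n I x j).degree < I := by
  unfold PP
  rw [← Polynomial.mem_degreeLT]
  refine Submodule.sum_mem _ fun i hi => ?_
  rw [Polynomial.mem_degreeLT]
  exact (Polynomial.degree_C_mul_X_pow_le _ _).trans_lt (by exact_mod_cast Finset.mem_range.1 hi)

lemma PP_coeff (q n I : ℕ) (x : ℕ → ℕ → ℤ) (j i : ℕ) (hi : i < I) :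
    (PP q n I x j).coeff i = (x i j : ℝ) * ((q : ℝ) ^ (2 * n)) ^ j := by
  unfold PP
  simp only [Polynomial.finsetSum_coeff, Polynomial.coeff_C_mul_X_pow]
  simp [hi]

lemma EP_eq (q n I : ℕ) (x : ℕ → ℕ → ℤ) :
    EP (Real.log 2) 28 (PP q n I x) = fun t => ∑ j ∈ Finset.range 28, ∑ i ∈ Finset.range I,
      ((x i j : ℝ) * ((q : ℝ) ^ (2 * n)) ^ j) * (t ^ i * Real.exp (j * Real.log 2 * t)) := by
  ext t
  unfold EP PP
  refine Finset.sum_congr rfl fun j _ => ?_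
  rw [Polynomial.eval_finsetSum, Finset.sum_mul]
  refine Finset.sum_congr rfl fun i _ => ?_
  simp; ring

lemma GG_real (p q n I a b : ℕ) (hq : 0 < q) (hb : b ≤ 2 * n)
    (h : (2 : ℝ) ^ (Real.sqrt 2) = p / q) (x : ℕ → ℕ → ℤ) :
    ph (GG p q n I x a b) = EP (Real.log 2) 28 (PP q n I x) (ph ⟨a, b⟩) := by
  rw [EP_eq]
  unfold GG
  simp only [map_sum, map_mul, map_pow, map_intCast, map_natCast]
  refine Finset.sum_congr rfl fun j _ => Finset.sum_congr rfl fun i _ => ?_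
  rw [ee_real p q n a b hq hb h, mul_pow, ← Real.exp_nat_mul]
  have : ph (⟨a, b⟩ : ℤ√2) = a + b * Real.sqrt 2 := by simp [ph_apply]
  rw [this, ← mul_assoc (j : ℝ)]
  ring

lemma EP_bound (q n I M : ℕ) (hq : 0 < q) (hI1 : 1 ≤ I) (x : ℕ → ℕ → ℤ) (X : ℕ)
    (hx : ∀ i j, |x i j| ≤ X) (R t : ℝ) (hR : 1 ≤ R) (ht0 : 0 ≤ t) (ht : t ≤ R) :
    |iteratedDeriv M (EP (Real.log 2) 28 (PP q n I x)) t| ≤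
      (28 * I) * (X * (q : ℝ) ^ (56 * n) *
        (2 ^ M * ((I : ℝ) ^ I * R ^ I * 28 ^ M * Real.exp (28 * R)))) := by
  rw [EP_eq]
  rw [iteratedDeriv_fun_sum (by intro j _; fun_prop)]
  have hq1 : (1 : ℝ) ≤ q := by exact_mod_cast hq
  have key : ∀ j ∈ Finset.range 28, ∀ i ∈ Finset.range I,
      |iteratedDeriv M (fun t => ((x i j : ℝ) * ((q : ℝ) ^ (2 * n)) ^ j) *
        (t ^ i * Real.exp (j * Real.log 2 * t))) t| ≤ X * (q : ℝ) ^ (56 * n) *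
        (2 ^ M * ((I : ℝ) ^ I * R ^ I * 28 ^ M * Real.exp (28 * R))) := by
    intro j hj i hi
    rw [iteratedDeriv_const_mul _ (by fun_prop), abs_mul, abs_mul]
    have hj' := Finset.mem_range.1 hj
    have hi' := Finset.mem_range.1 hi
    have e1 : |(x i j : ℝ)| ≤ X := by exact_mod_cast hx i j
    have e2 : |((q : ℝ) ^ (2 * n)) ^ j| ≤ (q : ℝ) ^ (56 * n) := by
      rw [abs_of_nonneg (by positivity), ← pow_mul]
      exact pow_le_pow_right₀ hq1 (by nlinarith)
    have hlog0 : 0 ≤ Real.log 2 := Real.log_nonneg (by norm_num)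
    have hlog1 : Real.log 2 ≤ 1 := by linarith [Real.log_two_lt_d9]
    have hj2 : (j : ℝ) ≤ 28 := by exact_mod_cast hj'.le
    have e3 := deriv_bound I M i hI1 hi'.le R 28 (j * Real.log 2) t hR (by norm_num)
      (by positivity) (by nlinarith [(Nat.cast_nonneg j : (0 : ℝ) ≤ j)]) ht0 ht
    gcongr
  calc _ ≤ ∑ j ∈ Finset.range 28, ∑ i ∈ Finset.range I, (X * (q : ℝ) ^ (56 * n) *
        (2 ^ M * ((I : ℝ) ^ I * R ^ I * 28 ^ M * Real.exp (28 * R)))) := by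
        refine (Finset.abs_sum_le_sum_abs _ _).trans (Finset.sum_le_sum fun j hj => ?_)
        rw [iteratedDeriv_fun_sum (by intro i _; fun_prop)]
        exact (Finset.abs_sum_le_sum_abs _ _).trans (Finset.sum_le_sum fun i hi => key j hj i hi)
    _ = _ := by
        simp only [Finset.sum_const, Finset.card_range, nsmul_eq_mul]
        push_cast; ring

lemma main_ineq (p q n I : ℕ) (hn : 0 < n) (hp : 0 < p) (hq : 0 < q) (hI : 28 * I = 4 * n ^ 2)
    (h : (2 : ℝ) ^ (Real.sqrt 2) = p / q) (X : ℕ)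
    (hX : X = 4 * n ^ 2 * ((6 * n) ^ I * (2 * p * q) ^ (56 * n))) :
    ((n ^ 2 : ℕ) : ℝ) ^ (n ^ 2) ≤ Real.exp (n ^ 2 : ℕ) * ((6 * n : ℝ) ^ (n ^ 2) *
      ((X : ℝ) ^ 4 * (56 ^ (n ^ 2) * (I : ℝ) ^ I * Real.exp (28 * (6 * n))))) := by
  have hn2 : 0 < n ^ 2 := by positivity
  have hI1 : 1 ≤ I := by omega
  obtain ⟨x, hx0, hxX, hxv⟩ := siegel p q n I hn hp hq hI
  rw [← hX] at hxX
  set F := EP (Real.log 2) 28 (PP q n I x) with hF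
  let pt : ℕ × ℕ → ℝ := fun ab => ph ⟨ab.1, ab.2⟩
  have hptinj : Function.Injective pt := by
    intro u v huv
    have := ph_inj huv
    rw [Zsqrtd.ext_iff] at this
    simp only [Nat.cast_inj] at this
    exact Prod.ext this.1 this.2
  have hpteq : ∀ ab : ℕ × ℕ, pt ab = ab.1 + ab.2 * Real.sqrt 2 := fun ab => by
    simp [pt, ph_apply]
  have hptI : ∀ ab : ℕ × ℕ, ab.1 ≤ 2 * n → ab.2 ≤ 2 * n → pt ab ∈ Set.Icc (0 : ℝ) (6 * n) := by
    intro ab h1 h2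
    have h1' : (ab.1 : ℝ) ≤ 2 * n := by exact_mod_cast h1
    have h2' : (ab.2 : ℝ) ≤ 2 * n := by exact_mod_cast h2
    rw [hpteq]
    refine ⟨by positivity, ?_⟩
    nlinarith [sqrt_two_lt, (Nat.cast_nonneg ab.2 : (0 : ℝ) ≤ ab.2)]
  -- a nonvanishing point
  obtain ⟨a, ha, b, hb, hab⟩ : ∃ a < 2 * n, ∃ b < 2 * n, F (pt (a, b)) ≠ 0 := by
    by_contra! hcon
    have hz := EP_zeros (Real.log 2) (Real.log_pos (by norm_num)).ne' I 0 (6 * n) 28 (PP q n I x)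
      (fun j _ => PP_degree q n I x j)
      ((Finset.range (2 * n) ×ˢ Finset.range (2 * n)).map ⟨pt, hptinj⟩) (by
        intro z hz
        obtain ⟨ab, h1, rfl⟩ := Finset.mem_map.1 hz
        rw [Finset.mem_product, Finset.mem_range, Finset.mem_range] at h1
        exact ⟨hptI ab h1.1.le h1.2.le, hcon _ h1.1 _ h1.2⟩) (by
        simp only [Finset.card_map, Finset.card_product, Finset.card_range]
        rw [hI]; ring)
    obtain ⟨i, hi, j, hj, hij⟩ := hx0
    have h1 := PP_coeff q n I x j i hi
    rw [hz j hj, Polynomial.coeff_zero] at h1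
    have h2 : (x i j : ℝ) ≠ 0 := by exact_mod_cast hij
    have h3 : (q : ℝ) ≠ 0 := by positivity
    exact (mul_ne_zero h2 (by positivity)) h1.symm
  set t := pt (a, b) with ht
  have hFt : ph (GG p q n I x a b) = F t := GG_real p q n I a b hq hb.le h x
  have hGne : GG p q n I x a b ≠ 0 := by
    intro h0; rw [h0, map_zero] at hFt; exact hab hFt.symm
  have hlow : 1 ≤ |F t| * (X : ℝ) ^ 2 := by
    rw [← hFt]
    refine (one_le_ph _ hGne).trans (mul_le_mul_of_nonneg_left ?_ (abs_nonneg _))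
    exact_mod_cast GG_sz p q n I hn hp hq hI x X hX hxX a b ha.le hb.le
  have htI : t ∈ Set.Icc (0 : ℝ) (6 * n) := hptI (a, b) ha.le hb.le
  -- interpolation
  set Z := (Finset.range n ×ˢ Finset.range n).map ⟨pt, hptinj⟩ with hZ
  have hZm : ∀ z ∈ Z, z ∈ Set.Icc (0 : ℝ) (6 * n) ∧ F z = 0 := by
    intro z hz
    obtain ⟨ab, h1, rfl⟩ := Finset.mem_map.1 hz
    rw [Finset.mem_product, Finset.mem_range, Finset.mem_range] at h1
    refine ⟨hptI ab (by omega) (by omega), ?_⟩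
    have := GG_real p q n I ab.1 ab.2 hq (by omega) h x
    rw [hxv _ h1.1 _ h1.2, map_zero] at this
    exact this.symm
  have hZc : Z.card = n ^ 2 := by
    simp only [hZ, Finset.card_map, Finset.card_product, Finset.card_range]; ring
  obtain ⟨ξ, hξ, hint⟩ := interp_error F (EP_contDiff _ _ _) 0 (6 * n) (n ^ 2) Z hZm hZc t htI
  have hn1 : (1 : ℝ) ≤ n := by exact_mod_cast hn
  have hder := EP_bound q n I (n ^ 2) hq hI1 x X hxX (6 * n) ξ (by linarith) hξ.1 hξ.2
  rw [← hF] at hder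
  have hprod : |∏ z ∈ Z, (t - z)| ≤ (6 * n : ℝ) ^ (n ^ 2) := by
    rw [Finset.abs_prod, ← hZc]
    refine (Finset.prod_le_prod (fun z _ => abs_nonneg _) (g := fun _ => (6 * n : ℝ)) ?_).trans
      (by rw [Finset.prod_const])
    intro z hz
    have := (hZm z hz).1
    rw [abs_le]
    constructor <;> linarith [this.1, this.2, htI.1, htI.2]
  have hX2 : (28 * I : ℝ) * ((q : ℝ) ^ (56 * n) * (6 * n : ℝ) ^ I) ≤ X := by
    have hle : 28 * I * (q ^ (56 * n) * (6 * n) ^ I) ≤ X := by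
      rw [hX, hI, mul_comm ((6 * n) ^ I)]
      have : q ≤ 2 * p * q := Nat.le_mul_of_pos_left q (by positivity)
      gcongr
    exact_mod_cast hle
  have hup : |F t| * ((n ^ 2).factorial : ℝ) ≤ (6 * n : ℝ) ^ (n ^ 2) *
      ((X : ℝ) ^ 2 * (56 ^ (n ^ 2) * (I : ℝ) ^ I * Real.exp (28 * (6 * n)))) := by
    have h1 : |F t| * ((n ^ 2).factorial : ℝ) = |iteratedDeriv (n ^ 2) F ξ| * |∏ z ∈ Z, (t - z)| := by
      rw [← abs_mul, ← hint, abs_mul, abs_of_nonneg (by positivity : (0 : ℝ) ≤ ((n ^ 2).factorial : ℝ))]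
    rw [h1, mul_comm]
    refine mul_le_mul hprod (hder.trans ?_) (abs_nonneg _) (by positivity)
    have h56 : (56 : ℝ) ^ (n ^ 2) = 2 ^ (n ^ 2) * 28 ^ (n ^ 2) := by
      rw [← mul_pow]; norm_num
    rw [h56]
    calc _ = (28 * I : ℝ) * ((q : ℝ) ^ (56 * n) * (6 * n : ℝ) ^ I) * (X * (2 ^ (n ^ 2) * 28 ^ (n ^ 2) *
          (I : ℝ) ^ I * Real.exp (28 * (6 * n)))) := by ring
      _ ≤ X * (X * (2 ^ (n ^ 2) * 28 ^ (n ^ 2) *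
          (I : ℝ) ^ I * Real.exp (28 * (6 * n)))) := by gcongr
      _ = _ := by ring
  have hfac := Real.pow_div_factorial_le_exp _ (Nat.cast_nonneg (n ^ 2) : (0 : ℝ) ≤ ((n ^ 2 : ℕ) : ℝ)) (n ^ 2)
  rw [div_le_iff₀ (by positivity)] at hfac
  refine hfac.trans (mul_le_mul_of_nonneg_left ?_ (Real.exp_pos _).le)
  calc ((n ^ 2).factorial : ℝ) = 1 * ((n ^ 2).factorial : ℝ) := by ring
    _ ≤ (|F t| * (X : ℝ) ^ 2) * ((n ^ 2).factorial : ℝ) := by gcongr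
    _ = (|F t| * ((n ^ 2).factorial : ℝ)) * (X : ℝ) ^ 2 := by ring
    _ ≤ _ := mul_le_mul_of_nonneg_right hup (by positivity)
    _ = _ := by ring

lemma exp_nat_le (k : ℕ) : Real.exp k ≤ 3 ^ k := by
  rw [← Real.exp_one_pow]
  exact pow_le_pow_left₀ (Real.exp_pos _).le (by linarith [Real.exp_one_lt_d9]) _

lemma final_bound (p q m : ℕ) (hm : 0 < m) (hp : 0 < p) (hq : 0 < q)
    (h : (2 : ℝ) ^ (Real.sqrt 2) = p / q) :
    28 * m ≤ 1008 ^ 7 * 336 ^ 4 * (2 * p * q) ^ 224 * 3 ^ 168 := by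
  set n := 28 * m with hn
  set I := 112 * m ^ 2 with hIdef
  set D := 2 * p * q with hD
  have hn0 : 0 < n := by omega
  have hDpos : 0 < D := by positivity
  have hI : 28 * I = 4 * n ^ 2 := by rw [hn, hIdef]; ring
  have h7 : n ^ 2 = 7 * I := by omega
  have hI0 : 0 < I := by positivity
  have hnI : n ≤ I := by rw [hn, hIdef]; nlinarith
  have hIn : I ≤ n ^ 2 := by omega
  set X := 4 * n ^ 2 * ((6 * n) ^ I * D ^ (56 * n)) with hX
  have hXle : X ≤ (336 * n * D ^ 56) ^ I := by
    have e1 : 4 * n ^ 2 ≤ 56 ^ I := by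
      rw [← hI]
      calc 28 * I ≤ 28 ^ I * 2 ^ I := by
            refine Nat.mul_le_mul ?_ (Nat.lt_two_pow_self).le
            calc 28 = 28 ^ 1 := by norm_num
              _ ≤ 28 ^ I := Nat.pow_le_pow_right (by norm_num) hI0
        _ = 56 ^ I := by rw [← mul_pow]; norm_num
    have e2 : D ^ (56 * n) ≤ (D ^ 56) ^ I := by
      rw [← pow_mul]
      exact Nat.pow_le_pow_right hDpos (by omega)
    calc X ≤ 56 ^ I * ((6 * n) ^ I * (D ^ 56) ^ I) := by rw [hX]; gcongr
      _ = _ := by rw [← mul_pow, ← mul_pow]; congr 1; ring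
  have hmain := main_ineq p q n I hn0 hp hq hI h X hX
  have he1 := exp_nat_le (n ^ 2)
  have he2 : Real.exp (28 * (6 * n)) ≤ (3 : ℝ) ^ (168 * I) := by
    have := exp_nat_le (168 * n)
    have e : (28 * (6 * n) : ℝ) = ((168 * n : ℕ) : ℝ) := by push_cast; ring
    rw [e]
    exact this.trans (pow_le_pow_right₀ (by norm_num) (by omega))
  have hN : (n ^ 2) ^ (n ^ 2) ≤ 3 ^ (n ^ 2) * ((6 * n) ^ (n ^ 2) *
      (((336 * n * D ^ 56) ^ I) ^ 4 * (56 ^ (n ^ 2) * (n ^ 2) ^ I * 3 ^ (168 * I)))) := by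
    have hXr : (X : ℝ) ≤ (((336 * n * D ^ 56) ^ I : ℕ) : ℝ) := by exact_mod_cast hXle
    have hIr : (I : ℝ) ≤ ((n ^ 2 : ℕ) : ℝ) := by exact_mod_cast hIn
    have : ((n ^ 2 : ℕ) : ℝ) ^ (n ^ 2) ≤ 3 ^ (n ^ 2) * ((6 * n : ℝ) ^ (n ^ 2) *
      ((((336 * n * D ^ 56) ^ I : ℕ) : ℝ) ^ 4 * (56 ^ (n ^ 2) * ((n ^ 2 : ℕ) : ℝ) ^ I * 3 ^ (168 * I)))) := by
      refine hmain.trans ?_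
      gcongr
    exact_mod_cast this
  have hfin : ((n ^ 2) ^ 7) ^ I ≤
      (3 ^ 7 * (6 * n) ^ 7 * (336 * n * D ^ 56) ^ 4 * 56 ^ 7 * n ^ 2 * 3 ^ 168) ^ I := by
    calc ((n ^ 2) ^ 7) ^ I = (n ^ 2) ^ (n ^ 2) := by rw [← pow_mul, ← h7]
      _ ≤ _ := hN
      _ = _ := by
        rw [h7]
        simp only [mul_pow, ← pow_mul]
        ring
  have h1 := (Nat.pow_le_pow_iff_left hI0.ne').1 hfin
  have h2 : n ^ 13 * n ≤ n ^ 13 * (1008 ^ 7 * 336 ^ 4 * D ^ 224 * 3 ^ 168) := by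
    calc n ^ 13 * n = (n ^ 2) ^ 7 := by ring
      _ ≤ _ := h1
      _ = _ := by ring
  exact Nat.le_of_mul_le_mul_left h2 (by positivity)

lemma two_rpow_ne (p q : ℕ) (hp : 0 < p) (hq : 0 < q) : (2 : ℝ) ^ (Real.sqrt 2) ≠ p / q := by
  intro h
  have := final_bound p q (1008 ^ 7 * 336 ^ 4 * (2 * p * q) ^ 224 * 3 ^ 168 + 1) (by omega) hp hq h
  omega

lemma irr_main : Irrational ((Real.sqrt 2) ^ (Real.sqrt 2)) := by
  rintro ⟨r, hr⟩
  have hpos : (0 : ℝ) < (Real.sqrt 2) ^ (Real.sqrt 2) := by positivity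
  have hr0 : 0 < r := by rw [← hr] at hpos; exact_mod_cast hpos
  have h2 : (2 : ℝ) ^ (Real.sqrt 2) = (r : ℝ) ^ 2 := by
    rw [hr, pow_two, ← Real.mul_rpow (Real.sqrt_nonneg 2) (Real.sqrt_nonneg 2),
      Real.mul_self_sqrt (by norm_num)]
  have hnum : 0 < r.num := Rat.num_pos.2 hr0
  refine two_rpow_ne (r.num.toNat ^ 2) (r.den ^ 2) (pow_pos (by omega) 2) (pow_pos r.den_pos 2) ?_
  rw [h2]
  have h3 : ((r.num.toNat : ℕ) : ℝ) = (r.num : ℝ) := by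
    exact_mod_cast Int.toNat_of_nonneg hnum.le
  push_cast
  rw [h3, ← div_pow]
  congr 1
  exact_mod_cast (Rat.num_div_den r).symm

theorem constructive_witness :
    Irrational ((Real.sqrt 2) ^ (Real.sqrt 2)) ∧ Irrational (Real.sqrt 2) ∧
      (((Real.sqrt 2) ^ (Real.sqrt 2)) ^ (Real.sqrt 2)) = 2 ∧
      (∃ q : ℚ, (((Real.sqrt 2) ^ (Real.sqrt 2)) ^ (Real.sqrt 2)) = (q : ℝ)) ∧
      ∃ x y : ℝ, Irrational x ∧ Irrational y ∧ ∃ q : ℚ, x ^ y = (q : ℝ) := by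
  have h : (((Real.sqrt 2) ^ (Real.sqrt 2)) ^ (Real.sqrt 2)) = 2 := by
    rw [← Real.rpow_mul (Real.sqrt_nonneg 2), Real.mul_self_sqrt (by norm_num), Real.rpow_two,
      Real.sq_sqrt (by norm_num)]
  exact ⟨irr_main, irrational_sqrt_two, h, ⟨2, by rw [h]; norm_num⟩,
    _, _, irr_main, irrational_sqrt_two, 2, by rw [h]; norm_num⟩
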